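/- arXiv:1202.0763 — 7 statements merged into one kernel-verified Lean document; each statement's English description precedes it below -/
import Mathlib

section
/- For every complex number s with Re(s) > 1, one has ζ(s)·L(s,χ) = ∏_{p prime, p | d} (1 - p^{-s})^{-1} · p₁(s)² · p₂(2s), where ζ is the Riemann zeta function and L(s,χ) the Dirichlet L-function of χ. -/
open Complex NumberField Filter

noncomputable section

/-- The partial Euler product `∏_{p prime, χ(p) = ε} (1 - p^{-s})⁻¹`. -/
def eulerProd {d : ℕ} (χ : DirichletCharacter ℂ d) (ε : ℂ) (s : ℂ) : ℂ :=
  ∏' p : {p : Nat.Primes // χ ((p : Nat.Primes) : ℕ) = ε}, (1 - (((p : Nat.Primes) : ℕ) : ℂ) ^ (-s))⁻¹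

/-- `χ` is the Dirichlet character attached to the quadratic field `K`, i.e. the real
primitive quadratic character mod `d = |Δ_K|` given by the Kronecker symbol `(Δ_K/·)`:
at odd primes it is given by the Legendre symbol `(Δ_K/p)` and at `2` (when `2 ∤ d`)
by `χ₈(Δ_K)`. -/
def IsKroneckerCharacter (K : Type*) [Field K] [NumberField K] {d : ℕ}
    (χ : DirichletCharacter ℂ d) : Prop :=
  d = (NumberField.discr K).natAbs ∧ χ.IsPrimitive ∧ MulChar.IsQuadratic χ ∧
  (∀ (p : ℕ) (hp : p.Prime), p ≠ 2 →
    χ (p : ZMod d) = ((@legendreSym p ⟨hp⟩ (NumberField.discr K) : ℤ) : ℂ)) ∧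
  (¬ (2 : ℕ) ∣ d → χ ((2 : ℕ) : ZMod d) = ((ZMod.χ₈ ((NumberField.discr K : ℤ) : ZMod 8) : ℤ) : ℂ))

/-- If `‖g i‖ ≤ 1 / 2` for all `i` and `g` is absolutely summable, then `∏ (1 - g i)⁻¹`
converges. -/
lemma multipliable_inv_one_sub_of_norm_le_half {ι : Type*} {g : ι → ℂ}
    (hg : Summable fun i ↦ ‖g i‖) (hle : ∀ i, ‖g i‖ ≤ 1 / 2) :
    Multipliable fun i ↦ (1 - g i)⁻¹ := by
  have hlow (i : ι) : 1 / 2 ≤ ‖1 - g i‖ := by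
    have := norm_sub_norm_le (1 : ℂ) (g i)
    rw [norm_one] at this
    linarith [hle i]
  have heq : (fun i ↦ (1 - g i)⁻¹) = fun i ↦ 1 + g i / (1 - g i) := by
    funext i
    have : 1 - g i ≠ 0 := norm_pos_iff.mp (by linarith [hlow i])
    field_simp
    ring
  rw [heq]
  refine multipliable_one_add_of_summable ((hg.mul_left 2).of_nonneg_of_le
    (fun _ ↦ norm_nonneg _) fun i ↦ ?_)
  rw [norm_div, div_le_iff₀ (by linarith [hlow i])]
  nlinarith [hlow i, norm_nonneg (g i)]

/-- The partial Euler product over the primes with `χ p = ε` converges for `Re s > 1`, written as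
a product over all primes. -/
lemma hasProd_eulerProd {d : ℕ} (χ : DirichletCharacter ℂ d) (ε : ℂ) {s : ℂ} (hs : 1 < s.re) :
    HasProd (Set.mulIndicator {p : Nat.Primes | χ ((p : ℕ) : ZMod d) = ε}
      fun p ↦ (1 - (p : ℂ) ^ (-s))⁻¹) (eulerProd χ ε s) := by
  rw [← hasProd_subtype_iff_mulIndicator]
  have hsum : Summable fun p : Nat.Primes ↦ ‖((p : ℕ) : ℂ) ^ (-s)‖ :=
    (summable_riemannZetaSummand hs).comp_injective Nat.Primes.coe_nat_injective
  exact (multipliable_inv_one_sub_of_norm_le_half (hsum.comp_injective Subtype.val_injective)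
    fun p ↦ norm_prime_cpow_le_one_half p.1 hs).hasProd

/-- A product over the prime factors of `d`, written as a product over all primes. -/
lemma hasProd_mulIndicator_primeFactors {d : ℕ} (hd : d ≠ 0) (f : ℕ → ℂ) :
    HasProd (Set.mulIndicator {p : Nat.Primes | (p : ℕ) ∣ d} fun p ↦ f p)
      (∏ p ∈ d.primeFactors, f p) := by
  have hprod : ∏ p ∈ d.primeFactors, f p =
      ∏ p ∈ d.primeFactors.subtype Nat.Prime, Set.mulIndicator
        {p : Nat.Primes | (p : ℕ) ∣ d} (fun p ↦ f p) p := by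
    rw [← Finset.prod_subtype_of_mem f fun _ ↦ Nat.prime_of_mem_primeFactors]
    refine Finset.prod_congr rfl fun p hp ↦ ?_
    rw [Finset.mem_subtype] at hp
    exact (Set.mulIndicator_of_mem (s := {p : Nat.Primes | (p : ℕ) ∣ d})
      (Nat.dvd_of_mem_primeFactors hp) fun p ↦ f p).symm
  rw [hprod]
  refine hasProd_prod_of_ne_finset_one fun p hp ↦ Set.mulIndicator_of_notMem (fun h ↦ hp ?_) _
  exact Finset.mem_subtype.mpr (Nat.mem_primeFactors.mpr ⟨p.2, h, hd⟩)

/-- `ζ(s)·L(s,χ) = ∏_{p|d} (1-p^{-s})⁻¹ ⬝ p₁(s)² ⬝ p₂(2s)` for `Re s > 1`. -/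
theorem statement2 (K : Type*) [Field K] [NumberField K]
    (hK : Module.finrank ℚ K = 2) {d : ℕ} [NeZero d] (χ : DirichletCharacter ℂ d)
    (hχ : IsKroneckerCharacter K χ)
    (s : ℂ) (hs : 1 < s.re) :
    riemannZeta s * DirichletCharacter.LFunction χ s =
      (∏ p ∈ d.primeFactors, (1 - (p : ℂ) ^ (-s))⁻¹) * eulerProd χ 1 s ^ 2 *
        eulerProd χ (-1) (2 * s) := by
  obtain ⟨-, -, hquad, -⟩ := hχ
  have hs2 : 1 < (2 * s).re := by
    simp only [mul_re, re_ofNat, im_ofNat, zero_mul, sub_zero]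
    linarith
  rw [DirichletCharacter.LFunction_eq_LSeries χ hs]
  refine ((riemannZeta_eulerProduct_hasProd hs).mul
    (DirichletCharacter.LSeries_eulerProduct_hasProd χ hs)).unique ?_
  have hone := hasProd_eulerProd χ 1 hs
  rw [sq]
  convert ((hasProd_mulIndicator_primeFactors (NeZero.ne d) fun p ↦ (1 - (p : ℂ) ^ (-s))⁻¹).mul
    (hone.mul hone)).mul (hasProd_eulerProd χ (-1) hs2) using 1
  funext p
  have hzero : χ ((p : ℕ) : ZMod d) = 0 ↔ (p : ℕ) ∣ d := by
    rw [← not_iff_not, ← ZMod.isUnit_prime_iff_not_dvd p.2]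
    exact ⟨fun h ↦ by_contra fun hu ↦ h (χ.map_nonunit hu), fun hu ↦ (hu.map χ).ne_zero⟩
  have hsq : (p : ℂ) ^ (-(2 * s)) = ((p : ℂ) ^ (-s)) ^ 2 := by
    rw [← cpow_nat_mul]
    congr 1
    push_cast
    ring
  simp only [Set.mulIndicator_apply, Set.mem_ofPred_eq, ← hzero, hsq]
  rcases hquad ((p : ℕ) : ZMod d) with h | h | h
  · norm_num [h]
  · norm_num [h]
  · norm_num [h]
    rw [← mul_inv]
    ring
end
end

section
/- For every complex number s with Re(s) > 1, one has q₁(s) = ∏_{p prime, χ(p)=1} (1 - p^{-s})/(1 + p^{-s}) and q₂(s) = ∏_{p prime, χ(p)=-1} (1 - p^{-s})/(1 + p^{-s}). -/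
open Complex NumberField Filter

noncomputable section

/-- `q₁(s) = ζ(2s)/(ζ(s)L(s,χ)) ∏_{p|d} (1+p^{-s})`. -/
def qOne {d : ℕ} [NeZero d] (χ : DirichletCharacter ℂ d) (s : ℂ) : ℂ :=
  riemannZeta (2 * s) / (riemannZeta s * DirichletCharacter.LFunction χ s) *
    ∏ p ∈ d.primeFactors, (1 + (p : ℂ) ^ (-s))

/-- `q₂(s) = L(s,χ)/ζ(s) ∏_{p|d} (1-p^{-s})⁻¹`. -/
def qTwo {d : ℕ} [NeZero d] (χ : DirichletCharacter ℂ d) (s : ℂ) : ℂ :=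
  DirichletCharacter.LFunction χ s / riemannZeta s *
    ∏ p ∈ d.primeFactors, (1 - (p : ℂ) ^ (-s))⁻¹

theorem hasProd_primes_dvd (f : ℕ → ℂ) {n : ℕ} (hn : n ≠ 0) :
    HasProd (fun p : Nat.Primes ↦ if (p : ℕ) ∣ n then f p else 1) (∏ p ∈ n.primeFactors, f p) := by
  have h : HasProd ((n.primeFactors : Set ℕ).mulIndicator f) (∏ p ∈ n.primeFactors, f p) := by
    convert! hasProd_prod_of_ne_finset_one (L := .unconditional ℕ) (s := n.primeFactors)
      (f := (n.primeFactors : Set ℕ).mulIndicator f) (fun b hb ↦ ?_) using 1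
    · exact Finset.prod_congr rfl fun p hp ↦ (Set.mulIndicator_of_mem (by exact_mod_cast hp) f).symm
    · exact Set.mulIndicator_of_notMem (by exact_mod_cast hb) f
  have hsupp : Function.mulSupport ((n.primeFactors : Set ℕ).mulIndicator f) ⊆
      {p : ℕ | p.Prime} := fun p hp ↦ by
    have hp' := Set.mulSupport_mulIndicator_subset hp
    exact Nat.prime_of_mem_primeFactors (by exact_mod_cast hp')
  have h' : HasProd (fun p : Nat.Primes ↦ (n.primeFactors : Set ℕ).mulIndicator f p)
      (∏ p ∈ n.primeFactors, f p) := (hasProd_subtype_iff_of_mulSupport_subset hsupp).mpr h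
  refine h'.congr_fun fun p ↦ ?_
  simp [Set.mulIndicator_apply, p.prop, hn]

theorem DirichletCharacter.apply_prime_eq_zero_iff {d : ℕ} (χ : DirichletCharacter ℂ d)
    (p : Nat.Primes) : χ (p : ℕ) = 0 ↔ (p : ℕ) ∣ d := by
  rw [← not_iff_not, ← ZMod.isUnit_prime_iff_not_dvd p.prop]
  refine ⟨fun h ↦ by_contra fun hu ↦ h (χ.map_nonunit hu), fun hu ↦ (hu.map χ).ne_zero⟩

theorem one_sub_prime_cpow_ne_zero {s : ℂ} (hs : 1 < s.re) (p : Nat.Primes) :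
    1 - ((p : ℕ) : ℂ) ^ (-s) ≠ 0 := fun h ↦ by
  have := norm_prime_cpow_le_one_half p hs
  rw [← sub_eq_zero.mp h, norm_one] at this
  norm_num at this

theorem one_add_prime_cpow_ne_zero {s : ℂ} (hs : 1 < s.re) (p : Nat.Primes) :
    1 + ((p : ℕ) : ℂ) ^ (-s) ≠ 0 := fun h ↦ by
  have := norm_prime_cpow_le_one_half p hs
  rw [← neg_eq_of_add_eq_zero_right h, norm_neg, norm_one] at this
  norm_num at this

theorem natCast_cpow_neg_two_mul (n : ℕ) (s : ℂ) :
    (n : ℂ) ^ (-(2 * s)) = ((n : ℂ) ^ (-s)) ^ 2 := by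
  rw [← Complex.cpow_nat_mul]
  congr 1
  push_cast
  ring

/-- `q₁(s) = ∏_{χ(p)=1} (1-p^{-s})/(1+p^{-s})` and
`q₂(s) = ∏_{χ(p)=-1} (1-p^{-s})/(1+p^{-s})` for `Re s > 1`. -/
theorem statement4 (K : Type*) [Field K] [NumberField K]
    (hK : Module.finrank ℚ K = 2) {d : ℕ} [NeZero d] (χ : DirichletCharacter ℂ d)
    (hχ : IsKroneckerCharacter K χ)
    (s : ℂ) (hs : 1 < s.re) :
    qOne χ s = (∏' p : {p : Nat.Primes // χ ((p : Nat.Primes) : ℕ) = 1},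
        (1 - (((p : Nat.Primes) : ℕ) : ℂ) ^ (-s)) / (1 + (((p : Nat.Primes) : ℕ) : ℂ) ^ (-s))) ∧
    qTwo χ s = (∏' p : {p : Nat.Primes // χ ((p : Nat.Primes) : ℕ) = -1},
        (1 - (((p : Nat.Primes) : ℕ) : ℂ) ^ (-s)) / (1 + (((p : Nat.Primes) : ℕ) : ℂ) ^ (-s))) := by
  have hquad := hχ.2.2.1
  have hs2 : 1 < (2 * s).re := by
    simp only [mul_re, re_ofNat, im_ofNat, zero_mul, sub_zero]
    linarith
  have hζ := riemannZeta_eulerProduct_hasProd hs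
  have hζ₂ := riemannZeta_eulerProduct_hasProd hs2
  have hL := DirichletCharacter.LSeries_eulerProduct_hasProd χ hs
  have hζ0 := riemannZeta_ne_zero_of_one_lt_re hs
  have hL0 := DirichletCharacter.LSeries_ne_zero_of_one_lt_re χ hs
  rw [← DirichletCharacter.LFunction_eq_LSeries χ hs] at hL hL0
  constructor
  · refine (HasProd.tprod_eq ?_).symm
    refine (hasProd_subtype_iff_mulIndicator (s := {p : Nat.Primes | χ (p : ℕ) = 1})
      (f := fun p : Nat.Primes ↦ (1 - ((p : ℕ) : ℂ) ^ (-s)) / (1 + ((p : ℕ) : ℂ) ^ (-s)))).mpr ?_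
    refine HasProd.congr_fun ((hζ₂.div₀ (hζ.mul hL) (mul_ne_zero hζ0 hL0)).mul
      (hasProd_primes_dvd (fun p ↦ 1 + (p : ℂ) ^ (-s)) (NeZero.ne d))) fun p ↦ ?_
    have hm := one_sub_prime_cpow_ne_zero hs p
    have hp := one_add_prime_cpow_ne_zero hs p
    have hd := χ.apply_prime_eq_zero_iff p
    have hsq : 1 - (((p : ℕ) : ℂ) ^ (-s)) ^ 2 =
      (1 - ((p : ℕ) : ℂ) ^ (-s)) * (1 + ((p : ℕ) : ℂ) ^ (-s)) := by ring
    simp only [natCast_cpow_neg_two_mul, hsq, Set.mulIndicator_apply, Set.mem_ofPred_eq, ← hd]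
    rcases hquad (p : ℕ) with h | h | h <;> norm_num [h] <;> field_simp
  · refine (HasProd.tprod_eq ?_).symm
    refine (hasProd_subtype_iff_mulIndicator (s := {p : Nat.Primes | χ (p : ℕ) = -1})
      (f := fun p : Nat.Primes ↦ (1 - ((p : ℕ) : ℂ) ^ (-s)) / (1 + ((p : ℕ) : ℂ) ^ (-s)))).mpr ?_
    refine HasProd.congr_fun ((hL.div₀ hζ hζ0).mul
      (hasProd_primes_dvd (fun p ↦ (1 - (p : ℂ) ^ (-s))⁻¹) (NeZero.ne d))) fun p ↦ ?_
    have hm := one_sub_prime_cpow_ne_zero hs p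
    have hp := one_add_prime_cpow_ne_zero hs p
    have hd := χ.apply_prime_eq_zero_iff p
    simp only [Set.mulIndicator_apply, Set.mem_ofPred_eq, ← hd]
    rcases hquad (p : ℕ) with h | h | h <;> norm_num [h] <;> field_simp
end
end

section
/- For every s ∈ Ω, the series ∑_{n≥0} log q(2ⁿ s) / 2^{n+1} converges absolutely, where log denotes the principal branch of the complex logarithm. -/
open Complex Filter

/-- For `q` holomorphic and nonvanishing on `Ω = {Re s > 1}` with `q(s) → 1` as
`Re s → +∞`, the series `∑_{n≥0} log q(2ⁿs)/2^(n+1)` converges absolutely for `s ∈ Ω`,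
where `log` is the principal branch of the complex logarithm. -/
theorem statement8 (q : ℂ → ℂ) (hq : DifferentiableOn ℂ q {s : ℂ | 1 < s.re})
    (hq0 : ∀ s : ℂ, 1 < s.re → q s ≠ 0)
    (hqlim : ∀ ε > (0 : ℝ), ∃ σ : ℝ, ∀ s : ℂ, 1 < s.re → σ ≤ s.re → ‖q s - 1‖ < ε)
    (s : ℂ) (hs : 1 < s.re) :
    Summable fun n : ℕ => ‖Complex.log (q ((2 : ℂ) ^ n * s)) / (2 : ℂ) ^ (n + 1)‖ := by
  have hre (n : ℕ) : ((2 : ℂ) ^ n * s).re = 2 ^ n * s.re := by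
    simpa using Complex.re_ofReal_mul ((2 : ℝ) ^ n) s
  have hpow (n : ℕ) : (2 : ℝ) ^ n ≤ ((2 : ℂ) ^ n * s).re := by
    rw [hre]
    exact le_mul_of_one_le_right (by positivity) hs.le
  have hΩ (n : ℕ) : 1 < ((2 : ℂ) ^ n * s).re := by
    rw [hre]
    exact one_lt_mul_of_le_of_lt (one_le_pow₀ one_le_two) hs
  have hlim : Tendsto (fun n : ℕ => q ((2 : ℂ) ^ n * s)) atTop (nhds 1) := by
    rw [Metric.tendsto_nhds]
    intro ε hε
    obtain ⟨σ, hσ⟩ := hqlim ε hε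
    filter_upwards [(tendsto_pow_atTop_atTop_of_one_lt (one_lt_two (α := ℝ))).eventually_ge_atTop σ]
      with n hn
    rw [dist_eq_norm]
    exact hσ _ (hΩ n) (hn.trans (hpow n))
  have hlog : ∀ᶠ n : ℕ in atTop, ‖Complex.log (q ((2 : ℂ) ^ n * s))‖ < 1 := by
    have h := (hlim.clog Complex.one_mem_slitPlane).norm
    rw [Complex.log_one, norm_zero] at h
    exact h.eventually_lt_const one_pos
  refine Summable.of_norm_bounded_eventually_nat summable_geometric_two ?_
  filter_upwards [hlog] with n hn
  rw [norm_norm, norm_div, norm_pow, Complex.norm_ofNat, one_div, inv_pow, ← one_div]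
  gcongr
  · norm_num
  · exact n.le_succ
end

section
/- The function p : Ω → ℂ defined by p(s) = exp(−∑_{n≥0} log q(2ⁿ s)/2^{n+1}) satisfies the functional equation p(2s) = p(s)² · q(s) for all s ∈ Ω, and p(s) → 1 as Re(s) → +∞ (for every ε > 0 there exists σ such that |p(s) − 1| ≤ ε whenever s ∈ Ω and Re(s) ≥ σ). -/
open Complex Filter

theorem two_pow_mul_re (n : ℕ) (s : ℂ) : ((2 : ℂ) ^ n * s).re = 2 ^ n * s.re := by
  have h : (2 : ℂ) ^ n = ((2 ^ n : ℝ) : ℂ) := by push_cast; rfl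
  rw [h, Complex.re_ofReal_mul]

theorem re_le_two_pow_mul_re (n : ℕ) {s : ℂ} (hs : 0 ≤ s.re) : s.re ≤ ((2 : ℂ) ^ n * s).re := by
  rw [two_pow_mul_re]
  exact le_mul_of_one_le_left hs (one_le_pow₀ one_le_two)

theorem hasSum_div_two_pow_succ (δ : ℝ) : HasSum (fun n : ℕ => δ / 2 ^ (n + 1)) δ := by
  convert hasSum_geometric_two' δ using 2 with n
  rw [pow_succ']
  field_simp

theorem norm_div_two_pow_succ_le {z : ℂ} {δ : ℝ} (hz : ‖z‖ ≤ δ) (n : ℕ) :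
    ‖z / (2 : ℂ) ^ (n + 1)‖ ≤ δ / 2 ^ (n + 1) := by
  rw [norm_div, norm_pow, Complex.norm_ofNat]
  gcongr

theorem exists_norm_log_le {q : ℂ → ℂ}
    (hqlim : ∀ ε > (0 : ℝ), ∃ σ : ℝ, ∀ s : ℂ, 1 < s.re → σ ≤ s.re → ‖q s - 1‖ < ε)
    {δ : ℝ} (hδ : 0 < δ) :
    ∃ σ : ℝ, ∀ s : ℂ, 1 < s.re → σ ≤ s.re → ‖Complex.log (q s)‖ ≤ δ := by
  have hc : ContinuousAt Complex.log 1 := continuousAt_clog Complex.one_mem_slitPlane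
  obtain ⟨η, hη, h⟩ := Metric.continuousAt_iff.1 hc δ hδ
  obtain ⟨σ, hσ⟩ := hqlim η hη
  refine ⟨σ, fun s hs hs' => ?_⟩
  have := h (x := q s) (by simpa [dist_eq_norm] using hσ s hs hs')
  rw [Complex.log_one, dist_zero_right] at this
  exact this.le

theorem summable_log_div_two_pow {q : ℂ → ℂ}
    (hqlim : ∀ ε > (0 : ℝ), ∃ σ : ℝ, ∀ s : ℂ, 1 < s.re → σ ≤ s.re → ‖q s - 1‖ < ε)
    {s : ℂ} (hs : 1 < s.re) :
    Summable fun n : ℕ => Complex.log (q ((2 : ℂ) ^ n * s)) / (2 : ℂ) ^ (n + 1) := by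
  obtain ⟨σ, hσ⟩ := exists_norm_log_le hqlim one_pos
  refine (hasSum_div_two_pow_succ 1).summable.of_norm_bounded_eventually_nat ?_
  have ht : Tendsto (fun n : ℕ => (2 : ℝ) ^ n * s.re) atTop atTop :=
    (tendsto_pow_atTop_atTop_of_one_lt one_lt_two).atTop_mul_const (by linarith)
  filter_upwards [ht.eventually_ge_atTop σ] with n hn
  exact norm_div_two_pow_succ_le (hσ _ (hs.trans_le (re_le_two_pow_mul_re n (by linarith)))
    (by rwa [two_pow_mul_re])) n

/-- The function `p(s) = exp(−∑_{n≥0} log q(2ⁿs)/2^(n+1))` satisfies the functional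
equation `p(2s) = p(s)² q(s)` on `Ω = {Re s > 1}`, and `p(s) → 1` as `Re s → +∞`. -/
theorem statement9 (q : ℂ → ℂ) (hq : DifferentiableOn ℂ q {s : ℂ | 1 < s.re})
    (hq0 : ∀ s : ℂ, 1 < s.re → q s ≠ 0)
    (hqlim : ∀ ε > (0 : ℝ), ∃ σ : ℝ, ∀ s : ℂ, 1 < s.re → σ ≤ s.re → ‖q s - 1‖ < ε)
    (p : ℂ → ℂ)
    (hp : ∀ s : ℂ, p s = Complex.exp (-∑' n : ℕ, Complex.log (q ((2 : ℂ) ^ n * s)) / (2 : ℂ) ^ (n + 1))) :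
    (∀ s : ℂ, 1 < s.re → p (2 * s) = p s ^ 2 * q s) ∧
    (∀ ε > (0 : ℝ), ∃ σ : ℝ, ∀ s : ℂ, 1 < s.re → σ ≤ s.re → ‖p s - 1‖ ≤ ε) := by
  refine ⟨fun s hs => ?_, fun ε hε => ?_⟩
  · have hsum := (summable_log_div_two_pow hqlim hs).tsum_eq_zero_add
    have hshift : ∑' n : ℕ, Complex.log (q ((2 : ℂ) ^ n * (2 * s))) / (2 : ℂ) ^ (n + 1) =
        2 * ∑' n : ℕ, Complex.log (q ((2 : ℂ) ^ (n + 1) * s)) / (2 : ℂ) ^ (n + 1 + 1) := by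
      rw [← tsum_mul_left]
      refine tsum_congr fun n => ?_
      rw [← mul_assoc, ← pow_succ, pow_succ _ (n + 1)]
      field_simp
    rw [hp, hp, hshift, ← Complex.exp_nat_mul]
    rw [← Complex.exp_log (hq0 s hs), ← Complex.exp_add, hsum]
    congr 1
    simp only [pow_zero, one_mul, zero_add, pow_one]
    push_cast
    ring
  · obtain ⟨δ, hδ, h⟩ :=
      Metric.continuousAt_iff.1 (Complex.continuous_exp.continuousAt (x := 0)) ε hε
    obtain ⟨σ, hσ⟩ := exists_norm_log_le hqlim (half_pos hδ)
    refine ⟨σ, fun s hs hs' => ?_⟩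
    have hb : ‖∑' n : ℕ, Complex.log (q ((2 : ℂ) ^ n * s)) / (2 : ℂ) ^ (n + 1)‖ ≤ δ / 2 := by
      refine tsum_of_norm_bounded (hasSum_div_two_pow_succ _) fun n => ?_
      have hre := re_le_two_pow_mul_re n (s := s) (by linarith)
      exact norm_div_two_pow_succ_le (hσ _ (hs.trans_le hre) (hs'.trans hre)) n
    rw [hp, ← Complex.exp_zero, ← dist_eq_norm]
    refine (h ?_).le
    rw [dist_zero_right, norm_neg]
    linarith
end

section
/- If p : Ω → ℂ satisfies p(2s) = p(s)² · q(s) for all s ∈ Ω and p(s) → 1 as Re(s) → +∞, then p(s) ≠ 0 for all s ∈ Ω. -/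
open Complex Filter

/-- If `p` satisfies `p(2s) = p(s)² q(s)` on `Ω = {Re s > 1}` and `p(s) → 1` as
`Re s → +∞`, then `p` does not vanish on `Ω`. -/
theorem statement11 (q : ℂ → ℂ) (hq : DifferentiableOn ℂ q {s : ℂ | 1 < s.re})
    (hq0 : ∀ s : ℂ, 1 < s.re → q s ≠ 0)
    (hqlim : ∀ ε > (0 : ℝ), ∃ σ : ℝ, ∀ s : ℂ, 1 < s.re → σ ≤ s.re → ‖q s - 1‖ < ε)
    (p : ℂ → ℂ)
    (hpfe : ∀ s : ℂ, 1 < s.re → p (2 * s) = p s ^ 2 * q s)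
    (hplim : ∀ ε > (0 : ℝ), ∃ σ : ℝ, ∀ s : ℂ, 1 < s.re → σ ≤ s.re → ‖p s - 1‖ < ε)
    (s : ℂ) (hs : 1 < s.re) :
    p s ≠ 0 := by
  intro h
  have hre (n : ℕ) : ((2 : ℂ) ^ n * s).re = 2 ^ n * s.re := by
    rw [← Complex.ofReal_ofNat, ← Complex.ofReal_pow, Complex.re_ofReal_mul]
  have hone (n : ℕ) : 1 < ((2 : ℂ) ^ n * s).re := by
    rw [hre]
    nlinarith [one_le_pow₀ (one_le_two : (1 : ℝ) ≤ 2) (n := n)]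
  have hzero (n : ℕ) : p (2 ^ n * s) = 0 := by
    induction n with
    | zero => simpa using h
    | succ n ih => rw [pow_succ', mul_assoc, hpfe _ (hone n), ih]; simp
  obtain ⟨σ, hσ⟩ := hplim 1 one_pos
  obtain ⟨n, hn⟩ := pow_unbounded_of_one_lt σ (one_lt_two : (1 : ℝ) < 2)
  have hlarge : σ ≤ ((2 : ℂ) ^ n * s).re := by
    rw [hre]
    nlinarith [pow_pos (two_pos : (0 : ℝ) < 2) n]
  simpa [hzero n] using hσ _ (hone n) hlarge
end

section
/- For i = 1, 2 and every complex number s = σ + it with σ = Re(s) ≥ 2, one has |log qᵢ(s)| ≤ 16/(2^σ − 2), where log denotes the principal branch of the complex logarithm. -/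
open Complex NumberField Filter

noncomputable section

theorem norm_log_exp_le (z : ℂ) : ‖Complex.log (Complex.exp z)‖ ≤ ‖z‖ := by
  by_cases h : -Real.pi < z.im ∧ z.im ≤ Real.pi
  · rw [Complex.log_exp h.1 h.2]
  · have hre : (Complex.log (Complex.exp z)).re = z.re := by
      rw [Complex.log_re, Complex.norm_exp, Real.log_exp]
    have him : |(Complex.log (Complex.exp z)).im| ≤ Real.pi :=
      abs_le.2 ⟨(Complex.neg_pi_lt_log_im _).le, Complex.log_im_le_pi _⟩
    have hz : Real.pi ≤ |z.im| := by
      by_contra! hlt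
      exact h ⟨(abs_lt.1 hlt).1, (abs_lt.1 hlt).2.le⟩
    rw [← sq_le_sq₀ (norm_nonneg _) (norm_nonneg _), Complex.sq_norm, Complex.sq_norm,
      Complex.normSq_apply, Complex.normSq_apply, hre]
    have := sq_le_sq.2 (him.trans hz)
    linarith

theorem summable_primes_rpow_neg {σ : ℝ} (hσ : 2 ≤ σ) :
    Summable fun p : Nat.Primes ↦ ((p : ℕ) : ℝ) ^ (-σ) :=
  Nat.Primes.summable_rpow.2 (by linarith)

theorem tsum_primes_rpow_neg_le {σ : ℝ} (hσ : 2 ≤ σ) :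
    ∑' p : Nat.Primes, ((p : ℕ) : ℝ) ^ (-σ) ≤ 2 / ((2 : ℝ) ^ σ - 2) := by
  have h4 : (4 : ℝ) ≤ 2 ^ σ := by
    calc (4 : ℝ) = 2 ^ (2 : ℝ) := by norm_num
      _ ≤ 2 ^ σ := Real.rpow_le_rpow_of_exponent_le (by norm_num) hσ
  set r : ℝ := 2 / 2 ^ σ with hr
  have hr0 : 0 ≤ r := by positivity
  have hr1 : r < 1 := by rw [hr, div_lt_one (by positivity)]; linarith
  have hterm (k : ℕ) : (2 : ℕ) ^ k • (((2 ^ k : ℕ) : ℝ) ^ (-σ)) = r ^ k := by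
    rw [hr, div_pow, nsmul_eq_mul, Real.rpow_neg (by positivity)]
    push_cast
    rw [← Real.rpow_natCast_mul (by norm_num), mul_comm (k : ℝ) σ,
      Real.rpow_mul_natCast (by norm_num), div_eq_mul_inv]
  have hanti : ∀ ⦃m n : ℕ⦄, 0 < m → m ≤ n → ((n : ℝ) ^ (-σ)) ≤ (m : ℝ) ^ (-σ) := by
    intro m n hm hmn
    exact Real.rpow_le_rpow_of_nonpos (by exact_mod_cast hm) (by exact_mod_cast hmn)
      (by linarith)
  have hbound (N : ℕ) : ∑ k ∈ Finset.Ico (1 : ℕ) (2 ^ N), (k : ℝ) ^ (-σ) ≤ (1 - r)⁻¹ := by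
    refine (Finset.le_sum_condensed' hanti N).trans ?_
    simp_rw [hterm]
    rw [← tsum_geometric_of_lt_one hr0 hr1]
    exact (summable_geometric_of_lt_one hr0 hr1).sum_le_tsum _ fun _ _ ↦ by positivity
  have hval : (1 - r)⁻¹ - 1 = 2 / ((2 : ℝ) ^ σ - 2) := by
    have h1 : (2 : ℝ) ^ σ ≠ 0 := by positivity
    have h2 : (2 : ℝ) ^ σ - 2 ≠ 0 := by linarith
    have h3 : 1 - r = ((2 : ℝ) ^ σ - 2) / 2 ^ σ := by rw [hr]; field_simp
    rw [h3]
    field_simp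
    ring
  refine (summable_primes_rpow_neg hσ).tsum_le_of_sum_le fun T ↦ ?_
  rw [← hval, le_sub_iff_add_le]
  set U : Finset ℕ := T.map ⟨fun p : Nat.Primes ↦ (p : ℕ), fun _ _ h ↦ Subtype.ext h⟩ with hU
  have hprime : ∀ n ∈ U, n.Prime := by
    intro n hn
    obtain ⟨p, -, rfl⟩ := Finset.mem_map.1 hn
    exact p.2
  have h1U : 1 ∉ U := fun h ↦ Nat.not_prime_one (hprime 1 h)
  have hsum : ∑ p ∈ T, ((p : ℕ) : ℝ) ^ (-σ) + 1 = ∑ n ∈ insert 1 U, (n : ℝ) ^ (-σ) := by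
    rw [Finset.sum_insert h1U, hU, Finset.sum_map, add_comm, Nat.cast_one, Real.one_rpow]
    rfl
  rw [hsum]
  refine le_trans ?_ (hbound ((insert 1 U).sup id + 1))
  refine Finset.sum_le_sum_of_subset_of_nonneg (fun n hn ↦ ?_) fun _ _ _ ↦ by positivity
  rw [Finset.mem_Ico]
  constructor
  · rcases Finset.mem_insert.1 hn with rfl | h
    · exact le_rfl
    · exact (hprime n h).one_le
  · calc n ≤ (insert 1 U).sup id := Finset.le_sup (f := id) hn
      _ < (insert 1 U).sup id + 1 := Nat.lt_succ_self _
      _ < 2 ^ ((insert 1 U).sup id + 1) := Nat.lt_two_pow_self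

theorem Nat.Primes.rpow_neg_le_half {σ : ℝ} (hσ : 2 ≤ σ) (p : Nat.Primes) :
    ((p : ℕ) : ℝ) ^ (-σ) ≤ 1 / 2 := by
  have hp : (2 : ℝ) ≤ (p : ℕ) := by exact_mod_cast p.2.two_le
  calc ((p : ℕ) : ℝ) ^ (-σ) ≤ ((p : ℕ) : ℝ) ^ (-1 : ℝ) :=
        Real.rpow_le_rpow_of_exponent_le (by linarith) (by linarith)
    _ = ((p : ℕ) : ℝ)⁻¹ := Real.rpow_neg_one _
    _ ≤ 2⁻¹ := by gcongr
    _ = 1 / 2 := by norm_num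

theorem Nat.Primes.norm_cpow_neg (p : Nat.Primes) (s : ℂ) :
    ‖((p : ℕ) : ℂ) ^ (-s)‖ = ((p : ℕ) : ℝ) ^ (-s.re) := by
  simpa using Complex.norm_natCast_cpow_of_pos p.2.pos (-s)

theorem norm_log_one_add_le_of_norm_le_rpow {σ : ℝ} (hσ : 2 ≤ σ) (p : Nat.Primes) {z : ℂ}
    (hz : ‖z‖ ≤ ((p : ℕ) : ℝ) ^ (-σ)) :
    ‖Complex.log (1 + z)‖ ≤ 3 / 2 * ((p : ℕ) : ℝ) ^ (-σ) :=
  (Complex.norm_log_one_add_half_le_self (hz.trans (p.rpow_neg_le_half hσ))).trans (by gcongr)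

theorem norm_tsum_primes_le {σ : ℝ} (hσ : 2 ≤ σ) {f : Nat.Primes → ℂ}
    (hf : ∀ p, ‖f p‖ ≤ 8 * ((p : ℕ) : ℝ) ^ (-σ)) :
    ‖∑' p, f p‖ ≤ 16 / ((2 : ℝ) ^ σ - 2) := by
  have h := tsum_of_norm_bounded ((summable_primes_rpow_neg hσ).mul_left 8).hasSum hf
  rw [tsum_mul_left] at h
  calc ‖∑' p, f p‖ ≤ _ := h
    _ ≤ 8 * (2 / ((2 : ℝ) ^ σ - 2)) := by gcongr; exact tsum_primes_rpow_neg_le hσ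
    _ = 16 / ((2 : ℝ) ^ σ - 2) := by ring

theorem prod_primeFactors_eq_exp_tsum {d : ℕ} (hd : d ≠ 0) {g : ℕ → ℂ}
    (hg : ∀ p, p.Prime → g p ≠ 0) :
    ∏ p ∈ d.primeFactors, g p =
      Complex.exp (∑' p : Nat.Primes, if (p : ℕ) ∣ d then Complex.log (g p) else 0) := by
  let T : Finset Nat.Primes := d.primeFactors.subtype Nat.Prime
  have hT (p : Nat.Primes) : p ∈ T ↔ (p : ℕ) ∣ d :=
    Finset.mem_subtype.trans
      ⟨Nat.dvd_of_mem_primeFactors, fun h ↦ Nat.mem_primeFactors.2 ⟨p.2, h, hd⟩⟩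
  rw [tsum_eq_sum (s := T) fun p hp ↦ if_neg (mt (hT p).2 hp), Complex.exp_sum]
  symm
  refine Finset.prod_bij (fun p _ ↦ (p : ℕ))
    (fun p hp ↦ Nat.mem_primeFactors.2 ⟨p.2, (hT p).1 hp, hd⟩)
    (fun _ _ _ _ h ↦ Subtype.ext h)
    (fun p hp ↦ ⟨⟨p, Nat.prime_of_mem_primeFactors hp⟩,
      (hT _).2 (Nat.dvd_of_mem_primeFactors hp), rfl⟩)
    fun p hp ↦ ?_
  rw [if_pos ((hT p).1 hp), Complex.exp_log (hg p p.2)]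

/-- For `s = σ + it` with `σ = Re s ≥ 2`, `|log qᵢ(s)| ≤ 16/(2^σ − 2)` for `i = 1, 2`,
where `log` is the principal branch of the complex logarithm. -/
theorem statement14 (K : Type*) [Field K] [NumberField K]
    (hK : Module.finrank ℚ K = 2) {d : ℕ} [NeZero d] (χ : DirichletCharacter ℂ d)
    (hχ : IsKroneckerCharacter K χ)
    (s : ℂ) (hs : 2 ≤ s.re) :
    ‖Complex.log (qOne χ s)‖ ≤ 16 / ((2 : ℝ) ^ s.re - 2) ∧
    ‖Complex.log (qTwo χ s)‖ ≤ 16 / ((2 : ℝ) ^ s.re - 2) := by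
  have hx (p : Nat.Primes) : ‖((p : ℕ) : ℂ) ^ (-s)‖ ≤ ((p : ℕ) : ℝ) ^ (-s.re) :=
    (p.norm_cpow_neg s).le
  have hx1 (p : Nat.Primes) : ‖((p : ℕ) : ℂ) ^ (-s)‖ < 1 :=
    ((hx p).trans (p.rpow_neg_le_half hs)).trans_lt (by norm_num)
  have hζ₂ (p : Nat.Primes) : ‖-Complex.log (1 - ((p : ℕ) : ℂ) ^ (-(2 * s)))‖ ≤
      3 / 2 * ((p : ℕ) : ℝ) ^ (-s.re) := by
    rw [norm_neg, sub_eq_add_neg]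
    refine norm_log_one_add_le_of_norm_le_rpow hs p ?_
    rw [norm_neg, p.norm_cpow_neg]
    refine Real.rpow_le_rpow_of_exponent_le (by exact_mod_cast p.2.one_le) ?_
    simp
    linarith
  have hζ (p : Nat.Primes) : ‖-Complex.log (1 - ((p : ℕ) : ℂ) ^ (-s))‖ ≤
      3 / 2 * ((p : ℕ) : ℝ) ^ (-s.re) := by
    rw [norm_neg, sub_eq_add_neg]
    exact norm_log_one_add_le_of_norm_le_rpow hs p (by rw [norm_neg]; exact hx p)
  have hL (p : Nat.Primes) :
      ‖-Complex.log (1 - χ ((p : ℕ) : ZMod d) * ((p : ℕ) : ℂ) ^ (-s))‖ ≤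
      3 / 2 * ((p : ℕ) : ℝ) ^ (-s.re) := by
    rw [norm_neg, sub_eq_add_neg]
    refine norm_log_one_add_le_of_norm_le_rpow hs p ?_
    rw [norm_neg, norm_mul]
    exact (mul_le_of_le_one_left (norm_nonneg _) (χ.norm_le_one _)).trans (hx p)
  have hplus (p : Nat.Primes) :
      ‖if (p : ℕ) ∣ d then Complex.log (1 + ((p : ℕ) : ℂ) ^ (-s)) else 0‖ ≤
      3 / 2 * ((p : ℕ) : ℝ) ^ (-s.re) := by
    split_ifs
    · exact norm_log_one_add_le_of_norm_le_rpow hs p (hx p)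
    · rw [norm_zero]; positivity
  have hminus (p : Nat.Primes) :
      ‖if (p : ℕ) ∣ d then Complex.log (1 - ((p : ℕ) : ℂ) ^ (-s)) else 0‖ ≤
      3 / 2 * ((p : ℕ) : ℝ) ^ (-s.re) := by
    split_ifs
    · simpa using hζ p
    · rw [norm_zero]; positivity
  have hsum {f : Nat.Primes → ℂ} (hf : ∀ p, ‖f p‖ ≤ 3 / 2 * ((p : ℕ) : ℝ) ^ (-s.re)) :
      Summable f :=
    .of_norm_bounded ((summable_primes_rpow_neg hs).mul_left _) hf
  have eζ₂ := riemannZeta_eulerProduct_exp_log (s := 2 * s) (by simp; linarith)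
  have eζ := riemannZeta_eulerProduct_exp_log (s := s) (by linarith)
  have eL := DirichletCharacter.LSeries_eulerProduct_exp_log χ (s := s) (by linarith)
  rw [← DirichletCharacter.LFunction_eq_LSeries χ (by linarith)] at eL
  have eplus := prod_primeFactors_eq_exp_tsum (NeZero.ne d) (g := fun p ↦ 1 + (p : ℂ) ^ (-s)) <| by
    intro p hp h
    have := hx1 ⟨p, hp⟩
    rw [← neg_eq_of_add_eq_zero_right h] at this
    simp at this
  have eminus := prod_primeFactors_eq_exp_tsum (NeZero.ne d)
      (g := fun p ↦ 1 - (p : ℂ) ^ (-s)) <| by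
    intro p hp h
    have := hx1 ⟨p, hp⟩
    rw [← sub_eq_zero.1 h] at this
    simp at this
  constructor
  · rw [qOne, ← eζ₂, ← eζ, ← eL, eplus, ← Complex.exp_add, ← Complex.exp_sub, ← Complex.exp_add,
      ← (hsum hζ).tsum_add (hsum hL), ← (hsum hζ₂).tsum_sub ((hsum hζ).add (hsum hL)),
      ← ((hsum hζ₂).sub ((hsum hζ).add (hsum hL))).tsum_add (hsum hplus)]
    refine (norm_log_exp_le _).trans (norm_tsum_primes_le hs fun p ↦ ?_)
    have hpos : 0 ≤ ((p : ℕ) : ℝ) ^ (-s.re) := by positivity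
    refine (norm_add_le_of_le (norm_sub_le_of_le (hζ₂ p) (norm_add_le_of_le (hζ p) (hL p)))
      (hplus p)).trans ?_
    linarith
  · rw [qTwo, Finset.prod_inv_distrib, ← eζ, ← eL, eminus, ← Complex.exp_sub, ← Complex.exp_neg,
      ← Complex.exp_add, ← (hsum hL).tsum_sub (hsum hζ), ← sub_eq_add_neg,
      ← ((hsum hL).sub (hsum hζ)).tsum_sub (hsum hminus)]
    refine (norm_log_exp_le _).trans (norm_tsum_primes_le hs fun p ↦ ?_)
    have hpos : 0 ≤ ((p : ℕ) : ℝ) ^ (-s.re) := by positivity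
    refine (norm_sub_le_of_le (norm_sub_le_of_le (hL p) (hζ p)) (hminus p)).trans ?_
    linarith
end
end

section
/- For every prime p and every complex number s = σ + it with σ ≥ 2, one has |log((1 − p^{-s})/(1 + p^{-s}))| ≤ log((1 − p^{-σ})/(1 − 3p^{-σ})) ≤ 2/(p^σ − 3), where log on the left is the principal branch of the complex logarithm. -/
/-- Comparing Taylor coefficients, `|log (1 - w)|` is at most `-log (1 - |w|)`. -/
theorem Complex.norm_log_one_sub_le_neg_log {w : ℂ} (hw : ‖w‖ < 1) :
    ‖Complex.log (1 - w)‖ ≤ -Real.log (1 - ‖w‖) := by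
  have h := (hasSum_nat_add_iff' 1).mpr (Complex.hasSum_taylorSeries_neg_log hw)
  have h' := Real.hasSum_pow_div_log_of_abs_lt_one (x := ‖w‖) (by rwa [abs_norm])
  rw [← norm_neg]
  simp only [Finset.range_one, Finset.sum_singleton, Nat.cast_zero, div_zero, sub_zero] at h
  refine h.norm_le_of_bounded h' fun n ↦ ?_
  rw [norm_div, norm_pow, Complex.norm_natCast]
  push_cast
  exact le_rfl

theorem Complex.norm_log_one_sub_div_one_add_le {z : ℂ} (hz : ‖z‖ < 1 / 3) :
    ‖Complex.log ((1 - z) / (1 + z))‖ ≤ Real.log ((1 - ‖z‖) / (1 - 3 * ‖z‖)) := by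
  have hx : 0 < 1 - ‖z‖ := by linarith
  have hlower : 1 - ‖z‖ ≤ ‖1 + z‖ := by
    simpa using norm_sub_le_norm_add 1 z
  have hne : 1 + z ≠ 0 := norm_pos_iff.mp (hx.trans_le hlower)
  have hw : ‖2 * z / (1 + z)‖ ≤ 2 * ‖z‖ / (1 - ‖z‖) := by
    rw [norm_div, norm_mul, Complex.norm_ofNat]
    gcongr
  have hr : 2 * ‖z‖ / (1 - ‖z‖) < 1 := by
    rw [div_lt_one hx]
    linarith
  have heq : (1 - z) / (1 + z) = 1 - 2 * z / (1 + z) := by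
    field_simp
    ring
  have hinv : (1 - ‖z‖) / (1 - 3 * ‖z‖) = (1 - 2 * ‖z‖ / (1 - ‖z‖))⁻¹ := by
    rw [one_sub_div hx.ne', inv_div]
    ring
  rw [heq, hinv, Real.log_inv]
  refine (Complex.norm_log_one_sub_le_neg_log (hw.trans_lt hr)).trans ?_
  gcongr

theorem Real.log_one_sub_div_one_sub_three_mul_le {x : ℝ} (hx : 0 < x) (hx' : x < 1 / 3) :
    Real.log ((1 - x) / (1 - 3 * x)) ≤ 2 / (x⁻¹ - 3) := by
  have h3 : 0 < 1 - 3 * x := by linarith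
  have h1 : 0 < 1 - x := by linarith
  refine (Real.log_le_sub_one_of_pos (div_pos h1 h3)).trans_eq ?_
  have hinv : x⁻¹ - 3 = (1 - 3 * x) / x := by
    field_simp
  rw [hinv, div_div_eq_mul_div, div_sub_one h3.ne']
  ring

/-- For every prime `p` and complex `s = σ + it` with `σ ≥ 2`,
`|log((1 − p^{-s})/(1 + p^{-s}))| ≤ log((1 − p^{-σ})/(1 − 3p^{-σ})) ≤ 2/(p^σ − 3)`,
where the leftmost `log` is the principal branch of the complex logarithm. -/
theorem statement16 (p : ℕ) (hp : p.Prime) (s : ℂ) (hs : 2 ≤ s.re) :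
    ‖Complex.log ((1 - (p : ℂ) ^ (-s)) / (1 + (p : ℂ) ^ (-s)))‖ ≤
      Real.log ((1 - (p : ℝ) ^ (-s.re)) / (1 - 3 * (p : ℝ) ^ (-s.re))) ∧
    Real.log ((1 - (p : ℝ) ^ (-s.re)) / (1 - 3 * (p : ℝ) ^ (-s.re))) ≤
      2 / ((p : ℝ) ^ s.re - 3) := by
  have hp0 : (0 : ℝ) < p := by exact_mod_cast hp.pos
  have hp2 : (2 : ℝ) ≤ p := by exact_mod_cast hp.two_le
  have hpow : (4 : ℝ) ≤ (p : ℝ) ^ s.re := by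
    calc (4 : ℝ) ≤ (p : ℝ) ^ (2 : ℝ) := by
          rw [Real.rpow_two]
          nlinarith
      _ ≤ (p : ℝ) ^ s.re := Real.rpow_le_rpow_of_exponent_le (by linarith) hs
  have hnorm : ‖(p : ℂ) ^ (-s)‖ = (p : ℝ) ^ (-s.re) := by
    rw [Complex.norm_natCast_cpow_of_pos hp.pos, Complex.neg_re]
  have hsmall : (p : ℝ) ^ (-s.re) < 1 / 3 := by
    rw [Real.rpow_neg hp0.le, inv_lt_comm₀ (by linarith) (by norm_num)]
    linarith
  constructor
  · rw [← hnorm]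
    exact Complex.norm_log_one_sub_div_one_add_le (hnorm ▸ hsmall)
  · have h := Real.log_one_sub_div_one_sub_three_mul_le (Real.rpow_pos_of_pos hp0 _) hsmall
    rwa [← Real.rpow_neg hp0.le, neg_neg] at h
end
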